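/- Let A, B, C, X, Y, Z be six points in R^3 with the segments AB, BC disjoint from the segments XY, YZ. Suppose projection to a sphere (centered at a point O seeing all segments from outside) yields crossings where AB passes over XY, XY passes over BC, BC passes over YZ, and YZ passes over AB. Then no such configuration of points exists. -/

import Mathlib

noncomputable section

/-- Points of `ℝ³`. -/
abbrev E3 := EuclideanSpace ℝ (Fin 3)

/-- In the radial projection from the point `O`, the segment `AB` passes *over*
the segment `XY` at a crossing: there are interior points `p` of `AB` and `q` of
`XY` lying on the same ray from `O` (so they project to the same point of a
sphere centered at `O`) with `p` strictly closer to `O` than `q`. -/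
def Over (O A B X Y : E3) : Prop :=
  ∃ p ∈ openSegment ℝ A B, ∃ q ∈ openSegment ℝ X Y,
    SameRay ℝ (p - O) (q - O) ∧ dist O p < dist O q

section Helpers

variable {V : Type*} [AddCommGroup V] [Module ℝ V]

/-- Over relation seen from the origin, in scalar form. -/
def Ov (A B X Y : V) : Prop :=
  ∃ p ∈ openSegment ℝ A B, ∃ q ∈ openSegment ℝ X Y, ∃ l : ℝ, 1 < l ∧ q = l • p

/-- The forbidden configuration, seen from the origin. -/
structure Cfg (A B C X Y Z : V) : Prop where
  oAB : (0 : V) ∉ segment ℝ A B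
  oBC : (0 : V) ∉ segment ℝ B C
  oXY : (0 : V) ∉ segment ℝ X Y
  oYZ : (0 : V) ∉ segment ℝ Y Z
  d1 : Disjoint (segment ℝ A B) (segment ℝ X Y)
  d2 : Disjoint (segment ℝ A B) (segment ℝ Y Z)
  d3 : Disjoint (segment ℝ B C) (segment ℝ X Y)
  d4 : Disjoint (segment ℝ B C) (segment ℝ Y Z)
  o1 : Ov A B X Y
  o2 : Ov X Y B C
  o3 : Ov B C Y Z
  o4 : Ov Y Z A B

theorem Ov.flip {A B X Y : V} (h : Ov A B X Y) : Ov B A Y X := by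
  unfold Ov at *
  rwa [openSegment_symm ℝ B A, openSegment_symm ℝ Y X]

theorem Ov.flipl {A B X Y : V} (h : Ov A B X Y) : Ov B A X Y := by
  unfold Ov at *
  rwa [openSegment_symm ℝ B A]

theorem Ov.flipr {A B X Y : V} (h : Ov A B X Y) : Ov A B Y X := by
  unfold Ov at *
  rwa [openSegment_symm ℝ Y X]

theorem Cfg.rev {A B C X Y Z : V} (h : Cfg A B C X Y Z) : Cfg C B A Z Y X where
  oAB := by rw [segment_symm]; exact h.oBC
  oBC := by rw [segment_symm]; exact h.oAB
  oXY := by rw [segment_symm]; exact h.oYZ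
  oYZ := by rw [segment_symm]; exact h.oXY
  d1 := by rw [segment_symm ℝ C B, segment_symm ℝ Z Y]; exact h.d4
  d2 := by rw [segment_symm ℝ C B, segment_symm ℝ Y X]; exact h.d3
  d3 := by rw [segment_symm ℝ B A, segment_symm ℝ Z Y]; exact h.d2
  d4 := by rw [segment_symm ℝ B A, segment_symm ℝ Y X]; exact h.d1
  o1 := h.o3.flip
  o2 := h.o4.flip
  o3 := h.o1.flip
  o4 := h.o2.flip

theorem Cfg.swap {A B C X Y Z : V} (h : Cfg A B C X Y Z) : Cfg X Y Z C B A where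
  oAB := h.oXY
  oBC := h.oYZ
  oXY := by rw [segment_symm]; exact h.oBC
  oYZ := by rw [segment_symm]; exact h.oAB
  d1 := by rw [segment_symm ℝ C B]; exact h.d3.symm
  d2 := by rw [segment_symm ℝ B A]; exact h.d1.symm
  d3 := by rw [segment_symm ℝ C B]; exact h.d4.symm
  d4 := by rw [segment_symm ℝ B A]; exact h.d2.symm
  o1 := h.o2.flipr
  o2 := h.o3.flipl
  o3 := h.o4.flipr
  o4 := h.o1.flipl

/-- Disjoint convex sets have a consistent radial order. -/
theorem consistent {S T : Set V} (hS : Convex ℝ S) (hT : Convex ℝ T) (hd : Disjoint S T)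
    {p p' q q' : V} (hp : p ∈ S) (hp' : p' ∈ S) (hq : q ∈ T) (hq' : q' ∈ T)
    {l m : ℝ} (hl : 1 < l) (hql : q = l • p) (hm : 0 < m) (hqm : q' = m • p') : 1 < m := by
  by_contra hcon
  push Not at hcon
  have hlm : 0 < l - m := by linarith
  -- weight β with β l + (1-β) m = 1
  set b : ℝ := (1 - m) / (l - m) with hb
  have hb0 : 0 ≤ b := div_nonneg (by linarith) hlm.le
  have hb1 : b ≤ 1 := by rw [hb, div_le_one hlm]; linarith
  have hbe : b * l + (1 - b) * m = 1 := by
    rw [hb]; field_simp; ring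
  have h1 : b • q + (1 - b) • q' ∈ T := hT hq hq' hb0 (by linarith) (by ring)
  have h2 : (b * l) • p + ((1 - b) * m) • p' ∈ S :=
    hS hp hp' (mul_nonneg hb0 (by linarith)) (mul_nonneg (by linarith) hm.le) hbe
  rw [hql, hqm, smul_smul, smul_smul] at h1
  exact Set.disjoint_left.mp hd h2 h1

theorem Ov.cons {A B X Y : V} (h : Ov A B X Y) (hd : Disjoint (segment ℝ A B) (segment ℝ X Y))
    {p q : V} (hp : p ∈ segment ℝ A B) (hq : q ∈ segment ℝ X Y) {m : ℝ} (hm : 0 < m)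
    (hqm : q = m • p) : 1 < m := by
  obtain ⟨p1, hp1, q1, hq1, l, hl, e⟩ := h
  exact consistent (convex_segment A B) (convex_segment X Y) hd
    (openSegment_subset_segment ℝ _ _ hp1) hp (openSegment_subset_segment ℝ _ _ hq1) hq hl e hm hqm

theorem Cfg.ray {A B C X Y Z : V} (h : Cfg A B C X Y Z) {k : ℝ} (hk : 0 < k) :
    k • B ∉ segment ℝ X Y := by
  intro hm
  have h1 := h.o1.cons h.d1 (right_mem_segment ℝ A B) hm hk rfl
  have h2 := h.o2.cons h.d3.symm hm (left_mem_segment ℝ B C) (inv_pos.mpr hk)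
    (by rw [smul_smul, inv_mul_cancel₀ hk.ne', one_smul])
  have := inv_lt_one_of_one_lt₀ h1
  linarith

theorem Cfg.ray2 {A B C X Y Z : V} (h : Cfg A B C X Y Z) {k : ℝ} (hk : 0 < k) :
    k • B ∉ segment ℝ Y Z := by
  rw [segment_symm]; exact h.rev.ray hk

theorem Cfg.ind {A B C X Y Z : V} (h : Cfg A B C X Y Z) {a b : ℝ} (e : a • A + b • B = 0) :
    a = 0 ∧ b = 0 := by
  have hB : B ≠ 0 := fun hB => h.oAB (hB ▸ right_mem_segment ℝ A B)
  have ha : a = 0 := by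
    by_contra ha
    have hA : A = (-(a⁻¹ * b)) • B := by
      have : a⁻¹ • (a • A + b • B) = 0 := by rw [e, smul_zero]
      rw [smul_add, smul_smul, smul_smul, inv_mul_cancel₀ ha, one_smul] at this
      rw [neg_smul]; exact eq_neg_of_add_eq_zero_left this
    obtain ⟨p, hp, q, hq, l, hl, e1⟩ := h.o1
    have hps := openSegment_subset_segment ℝ _ _ hp
    have hqs := openSegment_subset_segment ℝ _ _ hq
    have : ∃ k : ℝ, p = k • B := by
      obtain ⟨s, t, hs, ht, hst, rfl⟩ := hp
      refine ⟨s * (-(a⁻¹ * b)) + t, ?_⟩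
      rw [add_smul, mul_smul, ← hA]
    obtain ⟨k, rfl⟩ := this
    rcases lt_trichotomy k 0 with hk | hk | hk
    · apply h.oAB
      have := convex_segment A B hps (right_mem_segment ℝ A B) (a := 1 / (1 - k)) (b := -k / (1 - k))
        (div_nonneg zero_le_one (by linarith)) (div_nonneg (by linarith) (by linarith))
        (by have : 1 - k ≠ 0 := by linarith
            field_simp
            ring)
      rw [smul_smul, ← add_smul] at this
      have e0 : 1 / (1 - k) * k + -k / (1 - k) = 0 := by ring
      rwa [e0, zero_smul] at this
    · rw [hk, zero_smul] at hps
      exact h.oAB hps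
    · rw [smul_smul] at e1
      rw [e1] at hqs
      exact h.ray (by positivity) hqs
  refine ⟨ha, ?_⟩
  rw [ha, zero_smul, zero_add] at e
  exact (smul_eq_zero.mp e).resolve_right hB

/-- `X, Y, Z` cannot be linearly independent. -/
theorem Cfg.dep {A B C X Y Z : V} (h : Cfg A B C X Y Z) :
    ¬ ∀ a b c : ℝ, a • X + b • Y + c • Z = 0 → a = 0 ∧ b = 0 ∧ c = 0 := by
  intro H
  obtain ⟨_, ⟨s1, r1, hs1, hr1, hsr1, rfl⟩, _, ⟨u1, w1, hu1, hw1, huw1, rfl⟩, l1, hl1, e1⟩ := h.o1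
  obtain ⟨_, ⟨u2, w2, hu2, hw2, huw2, rfl⟩, _, ⟨r2, t2, hr2, ht2, hrt2, rfl⟩, l2, hl2, e2⟩ := h.o2
  obtain ⟨_, ⟨r3, t3, hr3, ht3, hrt3, rfl⟩, _, ⟨w3, v3, hw3, hv3, hwv3, rfl⟩, l3, hl3, e3⟩ := h.o3
  obtain ⟨_, ⟨w4, v4, hw4, hv4, hwv4, rfl⟩, _, ⟨s4, r4, hs4, hr4, hsr4, rfl⟩, l4, hl4, e4⟩ := h.o4
  obtain rfl : r1 = 1 - s1 := by linarith
  obtain rfl : r2 = 1 - t2 := by linarith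
  obtain rfl : r3 = 1 - t3 := by linarith
  obtain rfl : r4 = 1 - s4 := by linarith
  obtain rfl : w1 = 1 - u1 := by linarith
  obtain rfl : w2 = 1 - u2 := by linarith
  obtain rfl : w3 = 1 - v3 := by linarith
  obtain rfl : w4 = 1 - v4 := by linarith
  clear hsr1 hrt2 hrt3 hsr4 huw1 huw2 hwv3 hwv4
  have f1 : (l3 * (t3 - t2)) • B = (l3 * l2 * t3) • (u2 • X + (1 - u2) • Y)
      - t2 • ((1 - v3) • Y + v3 • Z) := by
    linear_combination (norm := module) (l3 * t3) • e2 + t2 • e3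
  have f2 : (l1 * (s4 - s1)) • B = s4 • (u1 • X + (1 - u1) • Y)
      - (l1 * l4 * s1) • ((1 - v4) • Y + v4 • Z) := by
    linear_combination (norm := module) (-(l1 * s1)) • e4 - s4 • e1
  set D1 := l3 * (t3 - t2) with hD1
  set D2 := l1 * (s4 - s1) with hD2
  have key : (D2 * (l3 * l2 * t3 * u2) - D1 * (s4 * u1)) • X
      + (D2 * (l3 * l2 * t3 * (1 - u2) - t2 * (1 - v3))
        - D1 * (s4 * (1 - u1) - l1 * l4 * s1 * (1 - v4))) • Y
      + (- D2 * (t2 * v3) + D1 * (l1 * l4 * s1 * v4)) • Z = 0 := by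
    linear_combination (norm := module) D1 • f2 - D2 • f1
  obtain ⟨k1, k2, k3⟩ := H _ _ _ key
  have P1 : 0 < l3 * l2 * t3 * u2 := by positivity
  have P2 : 0 < s4 * u1 := by positivity
  have hsum : D2 * (l3 * l2 * t3 - t2) = D1 * (s4 - l1 * l4 * s1) := by
    linear_combination k1 + k2 + k3
  have i1 : D1 < l3 * l2 * t3 - t2 := by
    rw [hD1]
    have : 0 < l3 * t3 * (l2 - 1) := by have : 0 < l2 - 1 := by linarith
                                        positivity
    have : 0 < (l3 - 1) * t2 := by have : 0 < l3 - 1 := by linarith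
                                   positivity
    linarith
  have i2 : s4 - l1 * l4 * s1 < D2 := by
    rw [hD2]
    have : 0 < l1 * s1 * (l4 - 1) := by have : 0 < l4 - 1 := by linarith
                                        positivity
    have : 0 < (l1 - 1) * s4 := by have : 0 < l1 - 1 := by linarith
                                   positivity
    linarith
  rcases lt_trichotomy D1 0 with hD | hD | hD
  · have hD2n : D2 < 0 := by
      by_contra hc
      push Not at hc
      have := mul_nonneg hc P1.le
      have := mul_neg_of_neg_of_pos hD P2
      linarith
    have := mul_lt_mul_of_neg_left i1 hD2n
    have := mul_lt_mul_of_neg_left i2 hD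
    linarith
  · rw [hD, zero_smul] at f1
    have g : (l3 * l2 * t3 * u2) • X + (l3 * l2 * t3 * (1 - u2) - t2 * (1 - v3)) • Y
      + (-(t2 * v3)) • Z = 0 := by
      linear_combination (norm := module) - f1
    have := (H _ _ _ g).1
    linarith
  · have hD2p : 0 < D2 := by
      by_contra hc
      push Not at hc
      have := mul_nonpos_of_nonpos_of_nonneg hc P1.le
      have := mul_pos hD P2
      linarith
    have := mul_lt_mul_of_pos_left i1 hD2p
    have := mul_lt_mul_of_pos_left i2 hD
    linarith

/-- `C` is not in the cone spanned by `A, B`. -/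
theorem Cfg.cone {A B C X Y Z : V} (h : Cfg A B C X Y Z) {c1 c2 : ℝ} (hc1 : 0 ≤ c1)
    (hc2 : 0 < c2) (hC : C = c1 • B + c2 • A) : False := by
  obtain ⟨q2, hq2, _, ⟨r2, t2, hr2, ht2, hrt2, rfl⟩, l2, hl2, e2⟩ := h.o2
  obtain ⟨_, ⟨r3, t3, hr3, ht3, hrt3, rfl⟩, q3, hq3, l3, hl3, e3⟩ := h.o3
  have key : ∀ r t : ℝ, 0 < r → 0 < t → ∃ p ∈ segment ℝ A B,
      r • B + t • C = (r + t * (c1 + c2)) • p := by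
    intro r t hr ht
    have hpos : 0 < r + t * (c1 + c2) := by positivity
    refine ⟨((t * c2) / (r + t * (c1 + c2))) • A + ((r + t * c1) / (r + t * (c1 + c2))) • B,
      ⟨_, _, by positivity, by positivity, ?_, rfl⟩, ?_⟩
    · field_simp; ring
    · rw [smul_add, smul_smul, smul_smul, mul_div_cancel₀ _ hpos.ne', mul_div_cancel₀ _ hpos.ne', hC]
      module
  obtain ⟨p2, hp2, g2⟩ := key r2 t2 hr2 ht2
  obtain ⟨p3, hp3, g3⟩ := key r3 t3 hr3 ht3
  have pos2 : 0 < r2 + t2 * (c1 + c2) := by positivity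
  have pos3 : 0 < r3 + t3 * (c1 + c2) := by positivity
  have l20 : 0 < l2 := by linarith
  have l30 : 0 < l3 := by linarith
  -- at direction 2
  have a2 : 1 < l2⁻¹ * (r2 + t2 * (c1 + c2)) :=
    h.o1.cons h.d1 hp2 (openSegment_subset_segment ℝ _ _ hq2) (by positivity) (by
      rw [mul_smul, ← g2, e2, smul_smul, inv_mul_cancel₀ l20.ne', one_smul])
  have a3 : 1 < (l3 * (r3 + t3 * (c1 + c2)))⁻¹ :=
    h.o4.cons h.d2.symm (openSegment_subset_segment ℝ _ _ hq3) hp3 (by positivity) (by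
      rw [e3, g3, smul_smul l3, smul_smul, inv_mul_cancel₀ (by positivity), one_smul])
  have b2 : l2 < r2 + t2 * (c1 + c2) := by
    rw [inv_mul_eq_div, lt_div_iff₀ l20] at a2; linarith
  have b3 : l3 * (r3 + t3 * (c1 + c2)) < 1 := by
    by_contra hc
    push Not at hc
    have := inv_le_one_of_one_le₀ hc
    linarith
  have b3' : r3 + t3 * (c1 + c2) < 1 := by nlinarith
  have d2 : 0 < t2 * (c1 + c2 - 1) := by linarith
  have d3 : t3 * (c1 + c2 - 1) < 0 := by linarith
  have := (mul_pos_iff_of_pos_left ht2).mp d2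
  nlinarith

theorem Cfg.comb {A B C X Y Z : V} (h : Cfg A B C X Y Z) :
    ∃ c1 c2 : ℝ, c2 < 0 ∧ C = c1 • B + c2 • A := by
  have hdep := h.swap.dep
  push Not at hdep
  obtain ⟨a, b, c, e, hne⟩ := hdep
  have ha : a ≠ 0 := by
    intro ha
    have : c • A + b • B = 0 := by rw [ha] at e; linear_combination (norm := module) e
    exact hne ha (h.ind this).2 (h.ind this).1
  have hc : c ≠ 0 := by
    intro hc
    have : a • C + b • B = 0 := by rw [hc] at e; linear_combination (norm := module) e
    exact ha (h.rev.ind this).1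
  have hC : C = (-(a⁻¹ * b)) • B + (-(a⁻¹ * c)) • A := by
    have : a⁻¹ • (a • C + b • B + c • A) = 0 := by rw [e, smul_zero]
    rw [smul_add, smul_add, smul_smul, inv_mul_cancel₀ ha, one_smul] at this
    linear_combination (norm := module) this
  generalize -(a⁻¹ * b) = c1 at hC
  have hc2 : -(a⁻¹ * c) ≠ 0 := neg_ne_zero.mpr (mul_ne_zero (inv_ne_zero ha) hc)
  generalize -(a⁻¹ * c) = c2 at hC hc2
  refine ⟨c1, c2, ?_, hC⟩
  by_contra hneg
  have hc2' : 0 < c2 := lt_of_le_of_ne (not_lt.mp hneg) hc2.symm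
  rcases le_total 0 c1 with h1 | h1
  · exact h.cone h1 hc2' hC
  · refine h.rev.cone (c1 := c2⁻¹ * (-c1)) (c2 := c2⁻¹)
      (mul_nonneg (inv_nonneg.mpr hc2'.le) (by linarith)) (inv_pos.mpr hc2') ?_
    rw [hC, smul_add, smul_smul, smul_smul, inv_mul_cancel₀ hc2]
    module

/-- The segment `XY` meets the ray opposite to `B`. -/
theorem Cfg.opp {A B C X Y Z : V} (h : Cfg A B C X Y Z) {c1 c2 : ℝ} (hc2 : c2 < 0)
    (hC : C = c1 • B + c2 • A) :
    ∃ k i j : ℝ, k < 0 ∧ 0 < i ∧ k • B = i • X + j • Y := by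
  obtain ⟨_, ⟨s1, r1, hs1, hr1, hsr1, rfl⟩, q1, hq1, l1, hl1, e1⟩ := h.o1
  obtain ⟨q2, hq2, _, ⟨r2, t2, hr2, ht2, hrt2, rfl⟩, l2, hl2, e2⟩ := h.o2
  have m1 : 0 < l1 * s1 := by have : 0 < l1 := by linarith
                              positivity
  have m2 : 0 < -(t2 * c2) := by nlinarith
  have l20 : 0 < l2 := by linarith
  set S := -(t2 * c2) + l1 * s1 * l2 with hS
  have hSp : 0 < S := by positivity
  have hmem : (-(t2 * c2) / S) • q1 + (l1 * s1 * l2 / S) • q2 ∈ openSegment ℝ X Y :=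
    convex_openSegment X Y hq1 hq2 (by positivity) (by positivity) (by field_simp; exact hS.symm)
  have hB : (-(t2 * c2) / S) • q1 + (l1 * s1 * l2 / S) • q2
      = ((-(t2 * c2) * l1 * r1 + l1 * s1 * (r2 + t2 * c1)) / S) • B := by
    rw [hC] at e2
    linear_combination (norm := module) (-(t2 * c2) / S) • e1 - (l1 * s1 / S) • e2
  rw [hB] at hmem
  generalize (-(t2 * c2) * l1 * r1 + l1 * s1 * (r2 + t2 * c1)) / S = k at hmem
  have hseg := openSegment_subset_segment ℝ _ _ hmem
  obtain ⟨i, j, hi, hj, hij, e⟩ := hmem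
  refine ⟨k, i, j, ?_, hi, e.symm⟩
  by_contra hk
  rcases (not_lt.mp hk).eq_or_lt with hk | hk
  · rw [← hk, zero_smul] at hseg
    exact h.oXY hseg
  · exact h.ray hk hseg

theorem Cfg.false {A B C X Y Z : V} (h : Cfg A B C X Y Z) : False := by
  obtain ⟨c1, c2, hc2, hC⟩ := h.comb
  obtain ⟨z1, z2, hz2, hZ⟩ := h.swap.comb
  obtain ⟨k, i, j, hk, hi, e⟩ := h.opp hc2 hC
  have hA : A = (-(c2⁻¹ * c1)) • B + c2⁻¹ • C := by
    rw [hC, smul_add, smul_smul, smul_smul, inv_mul_cancel₀ hc2.ne]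
    module
  obtain ⟨k', i', j', hk', hi', e'⟩ := h.rev.opp (inv_lt_zero.mpr hc2) hA
  have hrel : (k' * i - k * (i' * z2)) • X + (k' * j - k * (i' * z1 + j')) • Y = 0 := by
    rw [hZ] at e'
    linear_combination (norm := module) k • e' - k' • e
  have h0 := (h.swap.ind hrel).1
  have p1 := mul_neg_of_neg_of_pos hk' hi
  have p2 := mul_pos_of_neg_of_neg hk (mul_neg_of_pos_of_neg hi' hz2)
  linarith

theorem sub_mem_openSegment {O A B p : V} (h : p ∈ openSegment ℝ A B) :
    p - O ∈ openSegment ℝ (A - O) (B - O) := by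
  obtain ⟨s, t, hs, ht, hst, rfl⟩ := h
  refine ⟨s, t, hs, ht, hst, ?_⟩
  obtain rfl : t = 1 - s := by linarith
  module

theorem add_mem_segment' {O A B p : V} (h : p ∈ segment ℝ (A - O) (B - O)) :
    p + O ∈ segment ℝ A B := by
  obtain ⟨s, t, hs, ht, hst, rfl⟩ := h
  refine ⟨s, t, hs, ht, hst, ?_⟩
  obtain rfl : t = 1 - s := by linarith
  module

theorem disj_sub {O A B X Y : V} (h : Disjoint (segment ℝ A B) (segment ℝ X Y)) :
    Disjoint (segment ℝ (A - O) (B - O)) (segment ℝ (X - O) (Y - O)) :=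
  Set.disjoint_left.mpr fun _ h1 h2 =>
    Set.disjoint_left.mp h (add_mem_segment' h1) (add_mem_segment' h2)

theorem zero_sub_mem {O A B : V} (h : O ∉ segment ℝ A B) :
    (0 : V) ∉ segment ℝ (A - O) (B - O) := fun h1 => h (by simpa using add_mem_segment' h1)

end Helpers

theorem Over.toOv {O A B X Y : E3} (h : Over O A B X Y) (hO : O ∉ segment ℝ A B) :
    Ov (A - O) (B - O) (X - O) (Y - O) := by
  obtain ⟨p, hp, q, hq, hr, hd⟩ := h
  have hpO : p - O ≠ 0 := fun e => hO (by
    rw [← sub_eq_zero.mp e]; exact openSegment_subset_segment ℝ _ _ hp)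
  obtain ⟨l, hl, e⟩ := hr.exists_nonneg_left hpO
  refine ⟨p - O, sub_mem_openSegment hp, q - O, sub_mem_openSegment hq, l, ?_, e.symm⟩
  rw [dist_comm O p, dist_comm O q, dist_eq_norm, dist_eq_norm, ← e, norm_smul,
    Real.norm_of_nonneg hl] at hd
  have := norm_pos_iff.mpr hpO
  by_contra hc
  push Not at hc
  nlinarith

/-- Non-realizability lemma: there is no configuration of six points
`A, B, C, X, Y, Z` in `ℝ³`, with the segments `AB`, `BC` disjoint from the
segments `XY`, `YZ` and a projection point `O` off all four segments, realizing
the cyclic over/under pattern `AB // XY`, `XY // BC`, `BC // YZ`, `YZ // AB`. -/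
theorem no_alternating_pattern (O A B C X Y Z : E3)
    (hO : O ∉ segment ℝ A B ∪ segment ℝ B C ∪ segment ℝ X Y ∪ segment ℝ Y Z)
    (h1 : Disjoint (segment ℝ A B) (segment ℝ X Y))
    (h2 : Disjoint (segment ℝ A B) (segment ℝ Y Z))
    (h3 : Disjoint (segment ℝ B C) (segment ℝ X Y))
    (h4 : Disjoint (segment ℝ B C) (segment ℝ Y Z)) :
    ¬ (Over O A B X Y ∧ Over O X Y B C ∧ Over O B C Y Z ∧ Over O Y Z A B) := by
  rintro ⟨o1, o2, o3, o4⟩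
  simp only [Set.mem_union, not_or] at hO
  obtain ⟨⟨⟨hAB, hBC⟩, hXY⟩, hYZ⟩ := hO
  exact Cfg.false (A := A - O) (B := B - O) (C := C - O) (X := X - O) (Y := Y - O) (Z := Z - O)
    ⟨zero_sub_mem hAB, zero_sub_mem hBC, zero_sub_mem hXY, zero_sub_mem hYZ,
      disj_sub h1, disj_sub h2, disj_sub h3, disj_sub h4,
      o1.toOv hAB, o2.toOv hXY, o3.toOv hBC, o4.toOv hYZ⟩

end
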